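/- arXiv:2110.04012 — 2 statements merged into one kernel-verified Lean document; each statement's English description precedes it below -/
import Mathlib

section
/- Let 1 ≤ p < ∞ and 0 < s < 1, and suppose Ω ⊂ ℝ^d is a nonempty, open, uniform, bounded set with 0 ≤ α, β < codim̲_A(∂Ω) and sp + α + β < codim̲_A(∂Ω). Then there exists a constant c > 0 such that ∫_Ω |f(x)|^p d_Ω(x)^{−sp−α−β} dx ≤ c ‖f‖^p_{W^{s,p;α,β}(Ω)} < ∞ for all f ∈ W^{s,p;α,β}(Ω); in particular W^{s,p;α,β}(Ω) embeds into L^p(Ω, d_Ω(·)^{−sp−α−β} dx). -/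
open MeasureTheory Metric Set Filter
open scoped ENNReal NNReal

noncomputable section

/-- Euclidean space `ℝ^d`. -/
abbrev Rd (d : ℕ) := EuclideanSpace ℝ (Fin d)

/-- `d_Ω(x)`: the distance from `x` to the boundary `∂Ω`. -/
def distBd {d : ℕ} (Ω : Set (Rd d)) (x : Rd d) : ℝ := Metric.infDist x (frontier Ω)

/-- The `p`-th power of the weighted Gagliardo seminorm `[f]_{W^{s,p;α,β}(Ω)}^p`, with
power-of-distance-to-the-boundary weights `d_Ω(y)^{-β} d_Ω(x)^{-α}`. -/
def gagP {d : ℕ} (Ω : Set (Rd d)) (s p α β : ℝ) (f : Rd d → ℝ) : ℝ≥0∞ :=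
  ∫⁻ x in Ω, ∫⁻ y in Ω, ENNReal.ofReal
    (|f x - f y| ^ p / dist x y ^ ((d : ℝ) + s * p)
      * distBd Ω y ^ (-β) * distBd Ω x ^ (-α))

/-- The weighted Gagliardo seminorm `[f]_{W^{s,p;α,β}(Ω)}`. -/
def gagSemi {d : ℕ} (Ω : Set (Rd d)) (s p α β : ℝ) (f : Rd d → ℝ) : ℝ≥0∞ :=
  gagP Ω s p α β f ^ (1 / p)

/-- Membership in the weighted fractional Sobolev space `W^{s,p;α,β}(Ω)`. -/
def memW {d : ℕ} (Ω : Set (Rd d)) (s p α β : ℝ) (f : Rd d → ℝ) : Prop :=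
  MemLp f (ENNReal.ofReal p) (volume.restrict Ω) ∧ gagP Ω s p α β f < ⊤

/-- The norm `‖f‖_{L^p(Ω)} + [f]_{W^{s,p;α,β}(Ω)}` (as an extended real). -/
def wNorm {d : ℕ} (Ω : Set (Rd d)) (s p α β : ℝ) (f : Rd d → ℝ) : ℝ≥0∞ :=
  eLpNorm f (ENNReal.ofReal p) (volume.restrict Ω) + gagSemi Ω s p α β f

/-- Membership in `W_0^{s,p;α,β}(Ω)`: the closure of `C_c^∞(Ω) ∩ W^{s,p;α,β}(Ω)` in
`W^{s,p;α,β}(Ω)`. -/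
def memW0 {d : ℕ} (Ω : Set (Rd d)) (s p α β : ℝ) (f : Rd d → ℝ) : Prop :=
  memW Ω s p α β f ∧ ∀ ε : ℝ, 0 < ε → ∃ φ : Rd d → ℝ,
    ContDiff ℝ (⊤ : ℕ∞) φ ∧ HasCompactSupport φ ∧ tsupport φ ⊆ Ω ∧ memW Ω s p α β φ ∧
    wNorm Ω s p α β (fun x => f x - φ x) < ENNReal.ofReal ε

/-- The defining set for the lower Assouad codimension: admissible exponents `q`. -/
def lowerCodimSet {d : ℕ} (E : Set (Rd d)) : Set ℝ :=
  {q : ℝ | 0 ≤ q ∧ ∃ C : ℝ, 1 ≤ C ∧ ∀ x ∈ E, ∀ r R : ℝ, 0 < r → r < R →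
    ENNReal.ofReal R < EMetric.diam E →
    volume (Metric.cthickening r E ∩ Metric.ball x R)
      ≤ ENNReal.ofReal (C * (r / R) ^ q) * volume (Metric.ball x R)}

/-- The lower Assouad codimension. -/
def lowerCodimA {d : ℕ} (E : Set (Rd d)) : ℝ := sSup (lowerCodimSet E)

/-- The upper Assouad codimension. -/
def upperCodimA {d : ℕ} (E : Set (Rd d)) : ℝ :=
  sInf {q : ℝ | 0 ≤ q ∧ ∃ c : ℝ, 0 < c ∧ ∀ x ∈ E, ∀ r R : ℝ, 0 < r → r < R →
    ENNReal.ofReal R < EMetric.diam E →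
    ENNReal.ofReal (c * (r / R) ^ q) * volume (Metric.ball x R)
      ≤ volume (Metric.cthickening r E ∩ Metric.ball x R)}

/-- The upper Minkowski dimension. -/
def upperMinkDim {d : ℕ} (E : Set (Rd d)) : ℝ :=
  sInf {t : ℝ | 0 ≤ t ∧
    Filter.limsup (fun r : ℝ =>
        volume (Metric.cthickening r E) * ENNReal.ofReal (r ^ (t - (d : ℝ))))
      (nhdsWithin 0 (Set.Ioi 0)) = 0}

/-- Uniform domain: any two points are joined by a `1`-Lipschitz (arc-length parameterized)
curve of length `≤ C|x-y|` staying quantitatively away from the boundary. -/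
def IsUniformDomain {d : ℕ} (Ω : Set (Rd d)) : Prop :=
  ∃ C : ℝ, 1 ≤ C ∧ ∀ x ∈ Ω, ∀ y ∈ Ω, ∃ (l : ℝ) (γ : ℝ → Rd d),
    0 ≤ l ∧ l ≤ C * dist x y ∧ γ 0 = x ∧ γ l = y ∧
    (∀ t ∈ Set.Icc 0 l, γ t ∈ Ω) ∧
    LipschitzOnWith 1 γ (Set.Icc 0 l) ∧
    ∀ t ∈ Set.Icc 0 l,
      min (dist (γ t) x) (dist (γ t) y) / C ≤ Metric.infDist (γ t) (frontier Ω)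

/-- `κ`-plumpness. -/
def IsPlump {d : ℕ} (κ : ℝ) (E : Set (Rd d)) : Prop :=
  ∀ r : ℝ, 0 < r → ENNReal.ofReal r < EMetric.diam E →
    ∀ x ∈ closure E, ∃ z ∈ Metric.closedBall x r, Metric.ball z (κ * r) ⊆ E

/-- `σ`-homogeneity: `|V(E,x,λ,r)| ≤ L r^d λ^σ` where
`V(E,x,λ,r) = {y : dist(y,E) ≤ r, |x-y| ≤ λ r}`. -/
def IsHomog {d : ℕ} (σ : ℝ) (E : Set (Rd d)) : Prop :=
  ∃ L : ℝ, 0 < L ∧ ∀ x ∈ E, ∀ lam r : ℝ, 1 ≤ lam → 0 < r →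
    volume (Metric.cthickening r E ∩ Metric.closedBall x (lam * r))
      ≤ ENNReal.ofReal (L * r ^ (d : ℝ) * lam ^ σ)

/-- The axis-parallel cube with corner `a` and side length `l`. -/
def cube {d : ℕ} (a : Rd d) (l : ℝ) : Set (Rd d) :=
  {y | ∀ i, y i ∈ Set.Icc (a i) (a i + l)}

/-- Muckenhoupt `A₁` class: `|Q|⁻¹ ∫_Q w ≤ A inf_Q w` for all cubes `Q`. -/
def IsA1 {d : ℕ} (w : Rd d → ℝ) : Prop :=
  (∀ x, 0 < w x) ∧ ∃ A : ℝ, 0 < A ∧ ∀ (a : Rd d) (l : ℝ), 0 < l →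
    ∫⁻ x in cube a l, ENNReal.ofReal (w x)
      ≤ ENNReal.ofReal (A * l ^ (d : ℝ)) * ⨅ y ∈ cube a l, ENNReal.ofReal (w y)

/-- The `p`-th power of the Gagliardo seminorm with general weights `w(x) v(y)`. -/
def gagPW {d : ℕ} (Ω : Set (Rd d)) (s p : ℝ) (w v f : Rd d → ℝ) : ℝ≥0∞ :=
  ∫⁻ x in Ω, ∫⁻ y in Ω, ENNReal.ofReal
    (|f x - f y| ^ p / dist x y ^ ((d : ℝ) + s * p) * w x * v y)

/-- Membership in `W^{s,p;w,v}(Ω)` for general weights. -/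
def memWgen {d : ℕ} (Ω : Set (Rd d)) (s p : ℝ) (w v f : Rd d → ℝ) : Prop :=
  MemLp f (ENNReal.ofReal p) (volume.restrict Ω) ∧ gagPW Ω s p w v f < ⊤

/-- The norm of `W^{s,p;w,v}(Ω)` (as an extended real). -/
def wNormGen {d : ℕ} (Ω : Set (Rd d)) (s p : ℝ) (w v f : Rd d → ℝ) : ℝ≥0∞ :=
  eLpNorm f (ENNReal.ofReal p) (volume.restrict Ω) + gagPW Ω s p w v f ^ (1 / p)

/-- Membership in `W_0^{s,p;w,v}(Ω)`. -/
def memW0gen {d : ℕ} (Ω : Set (Rd d)) (s p : ℝ) (w v f : Rd d → ℝ) : Prop :=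
  memWgen Ω s p w v f ∧ ∀ ε : ℝ, 0 < ε → ∃ φ : Rd d → ℝ,
    ContDiff ℝ (⊤ : ℕ∞) φ ∧ HasCompactSupport φ ∧ tsupport φ ⊆ Ω ∧ memWgen Ω s p w v φ ∧
    wNormGen Ω s p w v (fun x => f x - φ x) < ENNReal.ofReal ε

/-- Membership in `W_c^{s,p;w,v}(Ω)`: the closure of compactly supported measurable
functions. -/
def memWcgen {d : ℕ} (Ω : Set (Rd d)) (s p : ℝ) (w v f : Rd d → ℝ) : Prop :=
  memWgen Ω s p w v f ∧ ∀ ε : ℝ, 0 < ε → ∃ g : Rd d → ℝ,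
    Measurable g ∧ HasCompactSupport g ∧ tsupport g ⊆ Ω ∧ memWgen Ω s p w v g ∧
    wNormGen Ω s p w v (fun x => f x - g x) < ENNReal.ofReal ε

end

lemma ball_subset_of_le_infDist_frontier {d : ℕ} {Ω : Set (Rd d)} (hopen : IsOpen Ω) {z : Rd d}
    (hz : z ∈ Ω) {ρ : ℝ} (hρ : ρ ≤ distBd Ω z) : ball z ρ ⊆ Ω := by
  rcases le_or_gt ρ 0 with h0 | h0
  · simp [ball_eq_empty.2 h0]
  have hdisj : Disjoint (frontier Ω) (ball z ρ) := by
    rw [Set.disjoint_left]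
    intro w hw hwb
    have h1 : infDist z (frontier Ω) ≤ dist z w := infDist_le_dist_of_mem hw
    rw [mem_ball, dist_comm] at hwb
    unfold distBd at hρ
    linarith
  have hpre : IsPreconnected (ball z ρ) := (convex_ball z ρ).isPreconnected
  refine hpre.subset_left_of_subset_union hopen (isClosed_closure (s := Ω)).isOpen_compl ?_ ?_ ?_
  · exact Set.disjoint_left.2 fun w hw hw' => hw' (subset_closure hw)
  · intro w hw
    by_cases hc : w ∈ closure Ω
    · left
      by_contra hn
      exact Set.disjoint_left.1 hdisj ⟨hc, by rwa [hopen.interior_eq]⟩ hw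
    · exact Or.inr hc
  · exact ⟨z, mem_ball_self h0, hz⟩

/-- A nontrivial uniform domain is plump at small scales. -/
lemma IsUniformDomain.exists_plump {d : ℕ} {Ω : Set (Rd d)} (hunif : IsUniformDomain Ω)
    (hnt : Ω.Nontrivial) :
    ∃ κ r₀ : ℝ, 0 < κ ∧ κ ≤ 1 ∧ 0 < r₀ ∧ ∀ x ∈ Ω, ∀ r, 0 < r → r ≤ r₀ →
      ∃ z ∈ Ω, dist z x ≤ r ∧ κ * r ≤ distBd Ω z := by
  obtain ⟨C, hC, hcurve⟩ := hunif
  obtain ⟨a, ha, b, hb, hab⟩ := hnt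
  have hD : 0 < dist a b := dist_pos.2 hab
  refine ⟨C⁻¹, dist a b / 4, by positivity, inv_le_one_of_one_le₀ hC, by positivity, ?_⟩
  intro x hx r hr hr0
  obtain ⟨y, hy, hxy⟩ : ∃ y ∈ Ω, 2 * r ≤ dist x y := by
    by_contra! hcon
    have h1 := hcon a ha
    have h2 := hcon b hb
    have h3 := dist_triangle_left a b x
    linarith
  obtain ⟨l, γ, hl, -, hγ0, hγl, hγΩ, hlip, hdist⟩ := hcurve x hx y hy
  have hcont : ContinuousOn (fun t => dist (γ t) x) (Icc 0 l) :=
    continuous_dist.comp_continuousOn (hlip.continuousOn.prodMk continuousOn_const)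
  have hmem : r ∈ Icc (dist (γ 0) x) (dist (γ l) x) := by
    rw [hγ0, hγl, dist_self, dist_comm y x]
    constructor <;> linarith
  obtain ⟨t, ht, htr⟩ := intermediate_value_Icc hl hcont hmem
  have htr' : dist (γ t) x = r := htr
  refine ⟨γ t, hγΩ t ht, htr'.le, ?_⟩
  have h2 : r ≤ dist (γ t) y := by
    have := dist_triangle_left x y (γ t)
    linarith
  have h3 := hdist t ht
  rw [htr', min_eq_left h2] at h3
  unfold distBd
  rw [inv_mul_eq_div]
  exact h3

lemma exists_volume_ball_eq (d : ℕ) :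
    ∃ v : ℝ, 0 < v ∧ ∀ (x : Rd d) (r : ℝ), 0 < r →
      volume (ball x r) = ENNReal.ofReal (v * r ^ (d : ℝ)) := by
  have hfin : volume (ball (0 : Rd d) 1) ≠ ⊤ := measure_ball_lt_top.ne
  refine ⟨(volume (ball (0 : Rd d) 1)).toReal,
    ENNReal.toReal_pos (measure_ball_pos _ _ one_pos).ne' hfin, ?_⟩
  intro x r hr
  rw [Measure.addHaar_ball_of_pos _ _ hr, ENNReal.ofReal_mul ENNReal.toReal_nonneg,
    ENNReal.ofReal_toReal hfin, Real.rpow_natCast, mul_comm]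
  simp

lemma exists_mem_lowerCodimSet {d : ℕ} {E : Set (Rd d)} {τ : ℝ} (hτ0 : 0 ≤ τ)
    (hτ : τ < lowerCodimA E) : E.Nontrivial ∧ ∃ q ∈ lowerCodimSet E, τ < q := by
  constructor
  · by_contra hn
    rw [Set.not_nontrivial_iff] at hn
    have hset : lowerCodimSet E = Ici 0 := by
      ext q
      refine ⟨fun hq => hq.1, fun hq => ⟨hq, 1, le_rfl, ?_⟩⟩
      intro x _ r R _ _ hlt
      change ENNReal.ofReal R < ediam E at hlt
      rw [ediam_eq_zero_iff.2 hn] at hlt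
      exact absurd hlt not_lt_zero
    have : lowerCodimA E = 0 := by
      rw [lowerCodimA, hset]
      exact Real.sSup_of_not_bddAbove (not_bddAbove_Ici 0)
    linarith
  · refine exists_lt_of_lt_csSup ?_ hτ
    by_contra hn
    rw [Set.not_nonempty_iff_eq_empty] at hn
    rw [lowerCodimA, hn, Real.sSup_empty] at hτ
    linarith

lemma continuous_distBd {d : ℕ} (Ω : Set (Rd d)) : Continuous (distBd Ω) :=
  continuous_infDist_pt _

lemma distBd_le_add {d : ℕ} (Ω : Set (Rd d)) (x y : Rd d) :
    distBd Ω x ≤ distBd Ω y + dist x y := infDist_le_infDist_add_dist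

/-- Volume bound for the set of points `x` with `y` at distance at most `2 * M * distBd Ω x`
and `distBd Ω x` at most comparable to `distBd Ω y / M`. -/
lemma volume_shadow_le {d : ℕ} {Ω : Set (Rd d)} (hE : (frontier Ω).Nonempty) {q Cq v κ M : ℝ}
    (hq : 0 ≤ q) (hCq : 1 ≤ Cq)
    (hcodim : ∀ x ∈ frontier Ω, ∀ r R : ℝ, 0 < r → r < R →
      ENNReal.ofReal R < ediam (frontier Ω) →
      volume (cthickening r (frontier Ω) ∩ ball x R)
        ≤ ENNReal.ofReal (Cq * (r / R) ^ q) * volume (ball x R))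
    (hball : ∀ (x : Rd d) (r : ℝ), 0 < r → volume (ball x r) = ENNReal.ofReal (v * r ^ (d : ℝ)))
    (hv : 0 < v) (hκ : 0 < κ) (hκ1 : κ ≤ 1) (hM : 1 ≤ M) {y : Rd d} (hy : 0 < distBd Ω y)
    (hdiam : ENNReal.ofReal (6 / κ * distBd Ω y) < ediam (frontier Ω)) :
    volume {x | dist x y ≤ 2 * M * distBd Ω x ∧ κ * M / 2 * distBd Ω x ≤ distBd Ω y}
      ≤ ENNReal.ofReal (Cq * M ^ (-q) * (v * (6 / κ * distBd Ω y) ^ (d : ℝ))) := by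
  obtain ⟨e, he, hye⟩ := isClosed_frontier.exists_infDist_eq_dist hE y
  change distBd Ω y = dist y e at hye
  set δ := distBd Ω y with hδ
  have hM0 : 0 < M := by linarith
  have hR : 0 < 6 / κ * δ := by positivity
  have hr : 0 < 2 / (κ * M) * δ := by positivity
  have hrR : 2 / (κ * M) * δ / (6 / κ * δ) = (3 * M)⁻¹ := by field_simp; norm_num
  have hlt : 2 / (κ * M) * δ < 6 / κ * δ := by
    rw [← div_lt_one hR, hrR]
    exact inv_lt_one_of_one_lt₀ (by linarith)
  calc _ ≤ volume (cthickening (2 / (κ * M) * δ) (frontier Ω) ∩ ball e (6 / κ * δ)) := by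
        refine measure_mono fun x ⟨hx1, hx2⟩ => ?_
        have hx3 : distBd Ω x ≤ 2 / (κ * M) * δ := by
          rw [div_mul_eq_mul_div, le_div_iff₀ (by positivity)]
          linarith
        constructor
        · obtain ⟨w, hw, hxw⟩ := isClosed_frontier.exists_infDist_eq_dist hE x
          refine mem_cthickening_of_dist_le x w _ _ hw ?_
          rw [← hxw]
          exact hx3
        · rw [mem_ball]
          have h1 : dist x y ≤ 4 / κ * δ := by
            have : 2 * M * (2 / (κ * M) * δ) = 4 / κ * δ := by field_simp; norm_num
            rw [← this]
            exact hx1.trans (by gcongr)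
          have h2 : δ ≤ 1 / κ * δ := by
            rw [div_mul_eq_mul_div, le_div_iff₀ hκ]
            nlinarith
          have h3 : 6 / κ * δ = 4 / κ * δ + 1 / κ * δ + 1 / κ * δ := by ring
          have h4 : 0 < 1 / κ * δ := by positivity
          have := dist_triangle x y e
          linarith
    _ ≤ _ := hcodim e he _ _ hr hlt hdiam
    _ = ENNReal.ofReal (Cq * (3 * M)⁻¹ ^ q * (v * (6 / κ * δ) ^ (d : ℝ))) := by
        rw [hball _ _ hR, hrR, ← ENNReal.ofReal_mul (by positivity)]
    _ ≤ _ := by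
        apply ENNReal.ofReal_le_ofReal
        rw [Real.rpow_neg hM0.le, ← Real.inv_rpow hM0.le]
        have : (3 * M)⁻¹ ≤ M⁻¹ := inv_anti₀ hM0 (by linarith)
        gcongr

lemma rpow_abs_le_two_rpow_mul (a b : ℝ) {p : ℝ} (hp : 0 ≤ p) :
    |a| ^ p ≤ 2 ^ p * (|b| ^ p + |a - b| ^ p) := by
  have hb : 0 ≤ |b| ^ p := by positivity
  have hab : 0 ≤ |a - b| ^ p := by positivity
  have htri : |a| ≤ |b| + |a - b| := by
    have := abs_add_le b (a - b)
    simpa using this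
  rcases le_total |b| |a - b| with h | h
  · calc |a| ^ p ≤ (2 * |a - b|) ^ p := by gcongr; linarith
      _ = 2 ^ p * |a - b| ^ p := Real.mul_rpow (by norm_num) (abs_nonneg _)
      _ ≤ _ := by gcongr; linarith
  · calc |a| ^ p ≤ (2 * |b|) ^ p := by gcongr; linarith
      _ = 2 ^ p * |b| ^ p := Real.mul_rpow (by norm_num) (abs_nonneg _)
      _ ≤ _ := by gcongr; linarith

/-- Pairs `(x, y)` with `y` at distance at most `2 * M * distBd Ω x` from `x` and with boundary
distance at least `κ * M / 2 * distBd Ω x`. -/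
def visiblePairs {d : ℕ} (Ω : Set (Rd d)) (κ M : ℝ) : Set (Rd d × Rd d) :=
  {z | dist z.1 z.2 ≤ 2 * M * distBd Ω z.1 ∧ κ * M / 2 * distBd Ω z.1 ≤ distBd Ω z.2}

lemma measurableSet_visiblePairs {d : ℕ} (Ω : Set (Rd d)) (κ M : ℝ) :
    MeasurableSet (visiblePairs Ω κ M) := by
  have h1 : Continuous fun z : Rd d × Rd d => distBd Ω z.1 :=
    (continuous_distBd Ω).comp continuous_fst
  have h2 : Continuous fun z : Rd d × Rd d => distBd Ω z.2 :=
    (continuous_distBd Ω).comp continuous_snd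
  exact ((isClosed_le continuous_dist (continuous_const.mul h1)).inter
    (isClosed_le (continuous_const.mul h1) h2)).measurableSet

lemma distBd_le_of_mem_visiblePairs {d : ℕ} {Ω : Set (Rd d)} {κ M : ℝ} (hM : 1 ≤ M)
    {x y : Rd d} (h : (x, y) ∈ visiblePairs Ω κ M) : distBd Ω y ≤ 3 * M * distBd Ω x := by
  have h1 : dist x y ≤ 2 * M * distBd Ω x := h.1
  have h2 := distBd_le_add Ω y x
  rw [dist_comm] at h2
  have h3 : 0 ≤ distBd Ω x := infDist_nonneg
  nlinarith

lemma ball_subset_visiblePairs {d : ℕ} {Ω : Set (Rd d)} {κ M : ℝ} (hκ1 : κ ≤ 1)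
    (hM : 1 ≤ M) {x z : Rd d} (hzx : dist z x ≤ M * distBd Ω x)
    (hz : κ * (M * distBd Ω x) ≤ distBd Ω z) :
    ball z (κ * M / 2 * distBd Ω x) ⊆ {y | (x, y) ∈ visiblePairs Ω κ M} := by
  intro y hy
  rw [mem_ball] at hy
  have h0 : 0 ≤ M * distBd Ω x := mul_nonneg (by linarith) infDist_nonneg
  have h1 := dist_triangle_left x y z
  rw [dist_comm z y] at h1
  have h2 := distBd_le_add Ω z y
  rw [dist_comm z y] at h2
  constructor
  · change dist x y ≤ 2 * M * distBd Ω x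
    nlinarith
  · change κ * M / 2 * distBd Ω x ≤ distBd Ω y
    linarith

/-- The kernel `k(x)` which, integrated over the points visible from `x`, dominates
`2 ^ p * distBd Ω x ^ (-τ)`. -/
noncomputable def visibleKernel {d : ℕ} (Ω : Set (Rd d)) (v κ M p τ : ℝ) (x : Rd d) : ℝ :=
  2 ^ p * (v * (κ * M / 2 * distBd Ω x) ^ (d : ℝ))⁻¹ * distBd Ω x ^ (-τ)

lemma measurable_visibleKernel {d : ℕ} (Ω : Set (Rd d)) (v κ M p τ : ℝ) :
    Measurable (visibleKernel Ω v κ M p τ) := by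
  have := (continuous_distBd Ω).measurable
  unfold visibleKernel
  fun_prop

lemma visibleKernel_nonneg {d : ℕ} (Ω : Set (Rd d)) {v κ M : ℝ} (p τ : ℝ) (hv : 0 < v)
    (hκ : 0 < κ) (hM : 1 ≤ M) (x : Rd d) : 0 ≤ visibleKernel Ω v κ M p τ x := by
  have : 0 ≤ distBd Ω x := infDist_nonneg
  unfold visibleKernel
  positivity

lemma visibleKernel_eq {d : ℕ} {Ω : Set (Rd d)} {v κ M : ℝ} (p τ : ℝ)
    (hκ : 0 < κ) (hM : 1 ≤ M) {x : Rd d} (hx : 0 < distBd Ω x) :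
    visibleKernel Ω v κ M p τ x =
      2 ^ p * v⁻¹ * (κ * M / 2) ^ (-(d : ℝ)) * distBd Ω x ^ (-(d + τ)) := by
  unfold visibleKernel
  have h1 : 0 ≤ κ * M / 2 := by positivity
  rw [Real.mul_rpow h1 hx.le, mul_inv, mul_inv, ← Real.rpow_neg h1, ← Real.rpow_neg hx.le,
    neg_add, Real.rpow_add hx]
  ring

lemma rpow_abs_mul_le_lintegral {d : ℕ} {Ω : Set (Rd d)} (hopen : IsOpen Ω) {v κ M p τ : ℝ}
    (hball : ∀ (x : Rd d) (r : ℝ), 0 < r → volume (ball x r) = ENNReal.ofReal (v * r ^ (d : ℝ)))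
    (hv : 0 < v) (hκ : 0 < κ) (hκ1 : κ ≤ 1) (hM : 1 ≤ M) (hp : 1 ≤ p) (f : Rd d → ℝ)
    {x z : Rd d} (hx : 0 < distBd Ω x) (hzΩ : z ∈ Ω) (hzx : dist z x ≤ M * distBd Ω x)
    (hz : κ * (M * distBd Ω x) ≤ distBd Ω z) :
    ENNReal.ofReal (|f x| ^ p * distBd Ω x ^ (-τ)) ≤
      ∫⁻ y in Ω, (visiblePairs Ω κ M).indicator (fun w => ENNReal.ofReal
        (visibleKernel Ω v κ M p τ w.1 * (|f w.2| ^ p + |f w.1 - f w.2| ^ p))) (x, y) := by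
  set ρ := κ * M / 2 * distBd Ω x with hρ
  have hρ0 : 0 < ρ := by positivity
  have hsub : ball z ρ ⊆ Ω := by
    refine ball_subset_of_le_infDist_frontier hopen hzΩ (le_trans ?_ hz)
    have : 0 < κ * (M * distBd Ω x) := by positivity
    rw [hρ]
    linarith
  have hvol : 0 < v * ρ ^ (d : ℝ) := by positivity
  calc ENNReal.ofReal (|f x| ^ p * distBd Ω x ^ (-τ))
      = ∫⁻ _ in ball z ρ,
          ENNReal.ofReal ((v * ρ ^ (d : ℝ))⁻¹ * distBd Ω x ^ (-τ) * |f x| ^ p) := by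
        rw [setLIntegral_const, hball _ _ hρ0, ← ENNReal.ofReal_mul (by positivity)]
        congr 1
        field_simp
    _ ≤ ∫⁻ y in ball z ρ, (visiblePairs Ω κ M).indicator (fun w => ENNReal.ofReal
        (visibleKernel Ω v κ M p τ w.1 * (|f w.2| ^ p + |f w.1 - f w.2| ^ p))) (x, y) := by
        refine setLIntegral_mono' measurableSet_ball fun y hy => ?_
        have hxy : (x, y) ∈ visiblePairs Ω κ M := ball_subset_visiblePairs hκ1 hM hzx hz hy
        rw [Set.indicator_of_mem hxy]
        apply ENNReal.ofReal_le_ofReal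
        have h := rpow_abs_le_two_rpow_mul (f x) (f y) (p := p) (by linarith)
        calc (v * ρ ^ (d : ℝ))⁻¹ * distBd Ω x ^ (-τ) * |f x| ^ p
            ≤ (v * ρ ^ (d : ℝ))⁻¹ * distBd Ω x ^ (-τ) *
                (2 ^ p * (|f y| ^ p + |f x - f y| ^ p)) := by gcongr
          _ = _ := by simp only [visibleKernel, ← hρ]; ring
    _ ≤ _ := lintegral_mono_set hsub

lemma visibleKernel_mul_le {d : ℕ} {Ω : Set (Rd d)} {v κ M s p α β : ℝ} (hv : 0 < v)
    (hκ : 0 < κ) (hM : 1 ≤ M) (hs : 0 < s) (hp : 1 ≤ p) (hβ : 0 ≤ β) (f : Rd d → ℝ) {x y : Rd d}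
    (hx : 0 < distBd Ω x) (hy : 0 < distBd Ω y) (h : (x, y) ∈ visiblePairs Ω κ M) :
    visibleKernel Ω v κ M p (s * p + α + β) x * |f x - f y| ^ p ≤
      2 ^ p * v⁻¹ * (κ * M / 2) ^ (-(d : ℝ)) * (2 * M) ^ (d + s * p) * (3 * M) ^ β *
        (|f x - f y| ^ p / dist x y ^ ((d : ℝ) + s * p)
          * distBd Ω y ^ (-β) * distBd Ω x ^ (-α)) := by
  have hp0 : p ≠ 0 := by linarith
  rcases eq_or_ne x y with rfl | hxy
  · simp [Real.zero_rpow hp0]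
  have hD : 0 < dist x y := dist_pos.2 hxy
  rw [visibleKernel_eq p _ hκ hM hx]
  set δ := distBd Ω x
  have hM0 : 0 < M := by linarith
  have h1 : δ ^ (-((d : ℝ) + s * p)) ≤
      (2 * M) ^ ((d : ℝ) + s * p) * (dist x y ^ ((d : ℝ) + s * p))⁻¹ := by
    rw [Real.rpow_neg hx.le, inv_le_iff_one_le_mul₀ (by positivity), mul_assoc, mul_comm (_⁻¹),
      ← mul_assoc, ← div_eq_mul_inv, one_le_div (by positivity),
      ← Real.mul_rpow (by positivity) hx.le]
    exact Real.rpow_le_rpow hD.le h.1 (by positivity)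
  have h2 : δ ^ (-β) ≤ (3 * M) ^ β * distBd Ω y ^ (-β) := by
    rw [Real.rpow_neg hx.le, Real.rpow_neg hy.le, inv_le_iff_one_le_mul₀ (by positivity),
      mul_assoc, mul_comm (_⁻¹), ← mul_assoc, ← div_eq_mul_inv, one_le_div (by positivity),
      ← Real.mul_rpow (by positivity) hx.le]
    exact Real.rpow_le_rpow hy.le (distBd_le_of_mem_visiblePairs hM h) hβ
  have h3 : δ ^ (-(d + (s * p + α + β))) = δ ^ (-((d : ℝ) + s * p)) * δ ^ (-β) * δ ^ (-α) := by
    rw [← Real.rpow_add hx, ← Real.rpow_add hx]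
    ring_nf
  rw [h3]
  calc _ ≤ 2 ^ p * v⁻¹ * (κ * M / 2) ^ (-(d : ℝ)) *
        ((2 * M) ^ ((d : ℝ) + s * p) * (dist x y ^ ((d : ℝ) + s * p))⁻¹ *
          ((3 * M) ^ β * distBd Ω y ^ (-β)) * δ ^ (-α)) * |f x - f y| ^ p := by gcongr
    _ = _ := by rw [div_eq_mul_inv]; ring

/-- The constant bounding the integral of the kernel over a shadow. -/
noncomputable def shadowConst (d : ℕ) (κ Cq p τ : ℝ) : ℝ :=
  2 ^ p * Cq * (κ / 2) ^ (-(d : ℝ)) * 3 ^ (d + τ) * (6 / κ) ^ (d : ℝ)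

lemma shadowConst_mul_eq {d : ℕ} {κ Cq p τ v M q δ : ℝ} (hv : 0 < v) (hκ : 0 < κ) (hM : 0 < M)
    (hδ : 0 < δ) :
    2 ^ p * v⁻¹ * (κ * M / 2) ^ (-(d : ℝ)) * ((3 * M) ^ (d + τ) * δ ^ (-(d + τ))) *
        (Cq * M ^ (-q) * (v * (6 / κ * δ) ^ (d : ℝ))) =
      shadowConst d κ Cq p τ * M ^ (τ - q) * δ ^ (-τ) := by
  have hMd : 0 < M ^ (d : ℝ) := by positivity
  have hδd : 0 < δ ^ (d : ℝ) := by positivity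
  rw [shadowConst, Real.mul_rpow (by positivity) hδ.le, neg_add,
    Real.rpow_add hδ, Real.mul_rpow (by norm_num) hM.le, Real.rpow_add hM,
    show κ * M / 2 = κ / 2 * M by ring, Real.mul_rpow (by positivity) hM.le,
    sub_eq_add_neg, Real.rpow_add hM, Real.rpow_neg hM.le (d : ℝ), Real.rpow_neg hδ.le (d : ℝ)]
  generalize M ^ (d : ℝ) = a at *
  generalize δ ^ (d : ℝ) = b at *
  generalize (κ / 2) ^ (-(d : ℝ)) = c
  generalize (6 / κ) ^ (d : ℝ) = e
  field_simp

lemma visibleKernel_le {d : ℕ} {Ω : Set (Rd d)} {v κ M p τ : ℝ} (hv : 0 < v) (hκ : 0 < κ)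
    (hM : 1 ≤ M) (hτ : 0 ≤ τ) {x y : Rd d} (hy : 0 < distBd Ω y)
    (hxy : (x, y) ∈ visiblePairs Ω κ M) :
    visibleKernel Ω v κ M p τ x ≤
      2 ^ p * v⁻¹ * (κ * M / 2) ^ (-(d : ℝ)) *
        ((3 * M) ^ (d + τ) * distBd Ω y ^ (-(d + τ))) := by
  have hM0 : 0 < M := by linarith
  have h3 := distBd_le_of_mem_visiblePairs hM hxy
  have hx0 : 0 < distBd Ω x := pos_of_mul_pos_right (hy.trans_le h3) (by positivity)
  rw [visibleKernel_eq p _ hκ hM hx0]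
  have h2 : distBd Ω x ^ (-(d + τ)) ≤ (3 * M) ^ (d + τ) * distBd Ω y ^ (-(d + τ)) := by
    rw [Real.rpow_neg hx0.le, Real.rpow_neg hy.le, inv_le_iff_one_le_mul₀ (by positivity),
      mul_assoc, mul_comm (_⁻¹), ← mul_assoc, ← div_eq_mul_inv,
      one_le_div (by positivity), ← Real.mul_rpow (by positivity) hx0.le]
    exact Real.rpow_le_rpow hy.le h3 (by positivity)
  gcongr

lemma lintegral_visibleKernel_le {d : ℕ} {Ω : Set (Rd d)} (hE : (frontier Ω).Nonempty)
    {q Cq v κ M p τ : ℝ} (hq : 0 ≤ q) (hCq : 1 ≤ Cq)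
    (hcodim : ∀ x ∈ frontier Ω, ∀ r R : ℝ, 0 < r → r < R →
      ENNReal.ofReal R < ediam (frontier Ω) →
      volume (cthickening r (frontier Ω) ∩ ball x R)
        ≤ ENNReal.ofReal (Cq * (r / R) ^ q) * volume (ball x R))
    (hball : ∀ (x : Rd d) (r : ℝ), 0 < r → volume (ball x r) = ENNReal.ofReal (v * r ^ (d : ℝ)))
    (hv : 0 < v) (hκ : 0 < κ) (hκ1 : κ ≤ 1) (hM : 1 ≤ M) (hτ : 0 ≤ τ) {y : Rd d}
    (hy : 0 < distBd Ω y) (hdiam : ENNReal.ofReal (6 / κ * distBd Ω y) < ediam (frontier Ω)) :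
    ∫⁻ x, (visiblePairs Ω κ M).indicator
        (fun w => ENNReal.ofReal (visibleKernel Ω v κ M p τ w.1)) (x, y) ≤
      ENNReal.ofReal (shadowConst d κ Cq p τ * M ^ (τ - q) * distBd Ω y ^ (-τ)) := by
  have hM0 : 0 < M := by linarith
  have hAm : MeasurableSet {x | (x, y) ∈ visiblePairs Ω κ M} :=
    (measurableSet_visiblePairs Ω κ M).preimage (measurable_id.prodMk measurable_const)
  obtain ⟨K, hK⟩ : ∃ K, K = 2 ^ p * v⁻¹ * (κ * M / 2) ^ (-(d : ℝ)) *
    ((3 * M) ^ (d + τ) * distBd Ω y ^ (-(d + τ))) := ⟨_, rfl⟩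
  have hK0 : 0 ≤ K := by rw [hK]; positivity
  calc _ ≤ ∫⁻ x, {x | (x, y) ∈ visiblePairs Ω κ M}.indicator (fun _ => ENNReal.ofReal K) x := by
        refine lintegral_mono fun x => ?_
        by_cases hx : (x, y) ∈ visiblePairs Ω κ M
        · have hxA : x ∈ {x | (x, y) ∈ visiblePairs Ω κ M} := hx
          rw [Set.indicator_of_mem hx, Set.indicator_of_mem hxA, hK]
          exact ENNReal.ofReal_le_ofReal (visibleKernel_le hv hκ hM hτ hy hx)
        · rw [Set.indicator_of_notMem hx]
          exact zero_le
    _ = ENNReal.ofReal K * volume {x | (x, y) ∈ visiblePairs Ω κ M} := by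
        rw [lintegral_indicator_const hAm]
    _ ≤ ENNReal.ofReal K *
          ENNReal.ofReal (Cq * M ^ (-q) * (v * (6 / κ * distBd Ω y) ^ (d : ℝ))) :=
        mul_le_mul_right
          (volume_shadow_le hE hq hCq hcodim hball hv hκ hκ1 hM hy hdiam) _
    _ = _ := by
        rw [← ENNReal.ofReal_mul hK0, hK, shadowConst_mul_eq hv hκ hM0 hy]

lemma measurableSet_lt_distBd {d : ℕ} (Ω : Set (Rd d)) (η : ℝ) :
    MeasurableSet {x | η < distBd Ω x} :=
  measurableSet_lt measurable_const (continuous_distBd Ω).measurable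

lemma lintegral_visiblePairs_le_half {d : ℕ} {Ω : Set (Rd d)} {v κ M p τ t η : ℝ}
    (hM : 1 ≤ M) (hκM : 1 ≤ κ * M / 2) (hη : 0 < η)
    (hint : ∀ y, 0 < distBd Ω y → distBd Ω y ≤ 3 * M * t →
      ∫⁻ x, (visiblePairs Ω κ M).indicator
        (fun w => ENNReal.ofReal (visibleKernel Ω v κ M p τ w.1)) (x, y) ≤
      ENNReal.ofReal (1 / 2 * distBd Ω y ^ (-τ)))
    {f : Rd d → ℝ} (hf : Measurable f) :
    ∫⁻ x in Ω ∩ {x | η < distBd Ω x ∧ distBd Ω x < t}, ∫⁻ y in Ω,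
        (visiblePairs Ω κ M).indicator
          (fun w => ENNReal.ofReal (visibleKernel Ω v κ M p τ w.1 * |f w.2| ^ p)) (x, y) ≤
      ENNReal.ofReal (1 / 2) * ∫⁻ y in Ω ∩ {y | η < distBd Ω y},
        ENNReal.ofReal (|f y| ^ p * distBd Ω y ^ (-τ)) := by
  have hk := measurable_visibleKernel Ω v κ M p τ
  have hη' := measurableSet_lt_distBd Ω η
  have hmeas : Measurable fun w : Rd d × Rd d =>
      ENNReal.ofReal (visibleKernel Ω v κ M p τ w.1 * |f w.2| ^ p) := by fun_prop
  rw [lintegral_lintegral_swap (f := fun x y => (visiblePairs Ω κ M).indicator (fun w =>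
      ENNReal.ofReal (visibleKernel Ω v κ M p τ w.1 * |f w.2| ^ p)) (x, y))
      (hmeas.indicator (measurableSet_visiblePairs Ω κ M)).aemeasurable,
    Set.inter_comm Ω {y | η < distBd Ω y}, ← Measure.restrict_restrict hη',
    ← lintegral_const_mul' _ _ ENNReal.ofReal_ne_top, ← lintegral_indicator hη']
  refine lintegral_mono fun y => ?_
  have hT : MeasurableSet {x | η < distBd Ω x ∧ distBd Ω x < t} :=
    hη'.inter (measurableSet_lt (continuous_distBd Ω).measurable measurable_const)
  by_cases hex : ∃ x, (η < distBd Ω x ∧ distBd Ω x < t) ∧ (x, y) ∈ visiblePairs Ω κ M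
  · obtain ⟨x, ⟨hx1, hx2⟩, hxy⟩ := hex
    have hxy' : κ * M / 2 * distBd Ω x ≤ distBd Ω y := hxy.2
    have hy1 : η < distBd Ω y := by nlinarith
    have hy2 : distBd Ω y ≤ 3 * M * t :=
      (distBd_le_of_mem_visiblePairs hM hxy).trans (by gcongr)
    have hyS : y ∈ {y | η < distBd Ω y} := hy1
    rw [Set.indicator_of_mem hyS]
    calc _ ≤ ∫⁻ x, (visiblePairs Ω κ M).indicator (fun w =>
            ENNReal.ofReal (visibleKernel Ω v κ M p τ w.1 * |f w.2| ^ p)) (x, y) :=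
          setLIntegral_le_lintegral _ _
      _ = ∫⁻ x, ENNReal.ofReal (|f y| ^ p) * (visiblePairs Ω κ M).indicator (fun w =>
            ENNReal.ofReal (visibleKernel Ω v κ M p τ w.1)) (x, y) := by
          refine lintegral_congr fun x => ?_
          by_cases hx : (x, y) ∈ visiblePairs Ω κ M
          · rw [Set.indicator_of_mem hx, Set.indicator_of_mem hx, mul_comm,
              ENNReal.ofReal_mul (by positivity)]
          · rw [Set.indicator_of_notMem hx, Set.indicator_of_notMem hx, mul_zero]
      _ ≤ ENNReal.ofReal (|f y| ^ p) * ENNReal.ofReal (1 / 2 * distBd Ω y ^ (-τ)) := by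
          rw [lintegral_const_mul' _ _ ENNReal.ofReal_ne_top]
          exact mul_le_mul_right (hint y (hη.trans hy1) hy2) _
      _ = _ := by
          rw [← ENNReal.ofReal_mul (by positivity), ← ENNReal.ofReal_mul (by positivity)]
          congr 1
          ring
  · push Not at hex
    refine (lintegral_mono_set Set.inter_subset_right).trans ?_
    refine (setLIntegral_mono' hT (g := fun _ => 0) fun x hx => ?_).trans (by simp)
    exact (Set.indicator_of_notMem (hex x hx) _).le

/-- The weighted bound away from the boundary, with constants independent of the truncation. -/
lemma lintegral_truncated_le {d : ℕ} {Ω : Set (Rd d)} (hopen : IsOpen Ω)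
    (hpos : ∀ x ∈ Ω, 0 < distBd Ω x) {v κ M s p α β t r₀ η : ℝ}
    (hball : ∀ (x : Rd d) (r : ℝ), 0 < r → volume (ball x r) = ENNReal.ofReal (v * r ^ (d : ℝ)))
    (hv : 0 < v) (hκ : 0 < κ) (hκ1 : κ ≤ 1) (hM : 1 ≤ M) (hκM : 1 ≤ κ * M / 2)
    (hs : 0 < s) (hp : 1 ≤ p) (hα : 0 ≤ α) (hβ : 0 ≤ β) (ht : 0 < t) (hη : 0 < η)
    (htr : M * t ≤ r₀)
    (hplump : ∀ x ∈ Ω, ∀ r, 0 < r → r ≤ r₀ → ∃ z ∈ Ω, dist z x ≤ r ∧ κ * r ≤ distBd Ω z)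
    (hint : ∀ y, 0 < distBd Ω y → distBd Ω y ≤ 3 * M * t →
      ∫⁻ x, (visiblePairs Ω κ M).indicator
        (fun w => ENNReal.ofReal (visibleKernel Ω v κ M p (s * p + α + β) w.1)) (x, y) ≤
      ENNReal.ofReal (1 / 2 * distBd Ω y ^ (-(s * p + α + β))))
    {f : Rd d → ℝ} (hf : Measurable f) (hfin : ∫⁻ x in Ω, ENNReal.ofReal (|f x| ^ p) < ⊤) :
    ∫⁻ x in Ω ∩ {x | η < distBd Ω x}, ENNReal.ofReal (|f x| ^ p * distBd Ω x ^ (-(s * p + α + β)))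
      ≤ 2 * (ENNReal.ofReal (t ^ (-(s * p + α + β))) * (∫⁻ x in Ω, ENNReal.ofReal (|f x| ^ p)) +
        ENNReal.ofReal (2 ^ p * v⁻¹ * (κ * M / 2) ^ (-(d : ℝ)) * (2 * M) ^ (d + s * p) *
          (3 * M) ^ β) * gagP Ω s p α β f) := by
  set τ := s * p + α + β with hτ
  have hτ0 : 0 ≤ τ := by positivity
  set K := 2 ^ p * v⁻¹ * (κ * M / 2) ^ (-(d : ℝ)) * (2 * M) ^ (d + s * p) * (3 * M) ^ β with hK
  have hK0 : 0 ≤ K := by positivity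
  set g : Rd d → ℝ≥0∞ := fun x => ENNReal.ofReal (|f x| ^ p * distBd Ω x ^ (-τ)) with hg
  have hΩm := hopen.measurableSet
  have hδm := (continuous_distBd Ω).measurable
  have hweight : ∀ a : ℝ, 0 < a → ∀ x, a ≤ distBd Ω x →
      g x ≤ ENNReal.ofReal (a ^ (-τ)) * ENNReal.ofReal (|f x| ^ p) := by
    intro a ha x hax
    rw [← ENNReal.ofReal_mul (by positivity), mul_comm (a ^ (-τ))]
    refine ENNReal.ofReal_le_ofReal (mul_le_mul_of_nonneg_left ?_ (by positivity))
    exact Real.rpow_le_rpow_of_nonpos ha hax (by linarith)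
  have hI : ∫⁻ x in Ω ∩ {x | η < distBd Ω x}, g x ≠ ⊤ := by
    refine ne_top_of_le_ne_top (b := ENNReal.ofReal (η ^ (-τ)) *
      ∫⁻ x in Ω, ENNReal.ofReal (|f x| ^ p)) (ENNReal.mul_ne_top ENNReal.ofReal_ne_top hfin.ne) ?_
    rw [← lintegral_const_mul' _ _ ENNReal.ofReal_ne_top]
    refine le_trans (setLIntegral_mono' (hΩm.inter (measurableSet_lt_distBd Ω η)) ?_)
      (lintegral_mono_set Set.inter_subset_left)
    exact fun x hx => hweight η hη x (le_of_lt hx.2)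
  set T := Ω ∩ {x | η < distBd Ω x ∧ distBd Ω x < t} with hT
  have hTm : MeasurableSet T := hΩm.inter
    ((measurableSet_lt_distBd Ω η).inter (measurableSet_lt hδm measurable_const))
  have hk := measurable_visibleKernel Ω v κ M p τ
  have hvp := measurableSet_visiblePairs Ω κ M
  have hfar : ∫⁻ x in Ω ∩ {x | t ≤ distBd Ω x}, g x ≤
      ENNReal.ofReal (t ^ (-τ)) * ∫⁻ x in Ω, ENNReal.ofReal (|f x| ^ p) := by
    rw [← lintegral_const_mul' _ _ ENNReal.ofReal_ne_top]
    refine le_trans (setLIntegral_mono' (hΩm.inter (measurableSet_le measurable_const hδm)) ?_)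
      (lintegral_mono_set Set.inter_subset_left)
    exact fun x hx => hweight t ht x hx.2
  have hnear : ∫⁻ x in T, g x ≤ ENNReal.ofReal (1 / 2) *
      (∫⁻ x in Ω ∩ {x | η < distBd Ω x}, g x) + ENNReal.ofReal K * gagP Ω s p α β f := by
    have hmeas : Measurable fun w : Rd d × Rd d =>
      ENNReal.ofReal (visibleKernel Ω v κ M p τ w.1 * |f w.2| ^ p) := by fun_prop
    have hmeas' := hmeas.indicator hvp
    calc ∫⁻ x in T, g x
        ≤ ∫⁻ x in T, ∫⁻ y in Ω, (visiblePairs Ω κ M).indicator (fun w => ENNReal.ofReal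
            (visibleKernel Ω v κ M p τ w.1 * (|f w.2| ^ p + |f w.1 - f w.2| ^ p))) (x, y) := by
          refine setLIntegral_mono' hTm fun x hx => ?_
          have hx0 := hpos x hx.1
          obtain ⟨z, hzΩ, hzx, hz⟩ := hplump x hx.1 (M * distBd Ω x) (by positivity)
            (le_trans (by gcongr; exact hx.2.2.le) htr)
          exact rpow_abs_mul_le_lintegral hopen hball hv hκ hκ1 hM hp f hx0 hzΩ hzx hz
      _ ≤ ∫⁻ x in T, ((∫⁻ y in Ω, (visiblePairs Ω κ M).indicator (fun w => ENNReal.ofReal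
            (visibleKernel Ω v κ M p τ w.1 * |f w.2| ^ p)) (x, y)) + ∫⁻ y in Ω,
            ENNReal.ofReal K * ENNReal.ofReal (|f x - f y| ^ p / dist x y ^ ((d : ℝ) + s * p)
              * distBd Ω y ^ (-β) * distBd Ω x ^ (-α))) := by
          refine setLIntegral_mono' hTm fun x hx => ?_
          have hslice : Measurable fun y => (visiblePairs Ω κ M).indicator (fun w =>
              ENNReal.ofReal (visibleKernel Ω v κ M p τ w.1 * |f w.2| ^ p)) (x, y) :=
            hmeas'.comp measurable_prodMk_left
          rw [← lintegral_add_left hslice]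
          refine setLIntegral_mono' hΩm fun y hy => ?_
          by_cases hxy : (x, y) ∈ visiblePairs Ω κ M
          · have hk0 := visibleKernel_nonneg Ω p τ hv hκ hM x
            rw [Set.indicator_of_mem hxy, Set.indicator_of_mem hxy, mul_add,
              ENNReal.ofReal_add (by positivity) (by positivity),
              ← ENNReal.ofReal_mul hK0]
            refine add_le_add le_rfl (ENNReal.ofReal_le_ofReal ?_)
            exact visibleKernel_mul_le hv hκ hM hs hp hβ f (hpos x hx.1) (hpos y hy) hxy
          · rw [Set.indicator_of_notMem hxy]
            exact zero_le
      _ = (∫⁻ x in T, ∫⁻ y in Ω, (visiblePairs Ω κ M).indicator (fun w => ENNReal.ofReal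
            (visibleKernel Ω v κ M p τ w.1 * |f w.2| ^ p)) (x, y)) + ∫⁻ x in T, ∫⁻ y in Ω,
            ENNReal.ofReal K * ENNReal.ofReal (|f x - f y| ^ p / dist x y ^ ((d : ℝ) + s * p)
              * distBd Ω y ^ (-β) * distBd Ω x ^ (-α)) :=
          lintegral_add_left hmeas'.lintegral_prod_right' _
      _ ≤ _ := by
          refine add_le_add
            (lintegral_visiblePairs_le_half hM hκM hη hint hf) ?_
          rw [gagP, ← lintegral_const_mul' _ _ ENNReal.ofReal_ne_top]
          refine le_trans (lintegral_mono_set Set.inter_subset_left) (le_of_eq ?_)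
          exact lintegral_congr fun x => lintegral_const_mul' _ _ ENNReal.ofReal_ne_top
  have hsplit : ∫⁻ x in Ω ∩ {x | η < distBd Ω x}, g x ≤
      (∫⁻ x in T, g x) + ∫⁻ x in Ω ∩ {x | t ≤ distBd Ω x}, g x := by
    refine le_trans (lintegral_mono_set ?_) (lintegral_union_le g _ _)
    intro x hx
    rcases lt_or_ge (distBd Ω x) t with h | h
    · exact Or.inl ⟨hx.1, hx.2, h⟩
    · exact Or.inr ⟨hx.1, h⟩
  set I := ∫⁻ x in Ω ∩ {x | η < distBd Ω x}, g x
  set A := ENNReal.ofReal (t ^ (-τ)) * ∫⁻ x in Ω, ENNReal.ofReal (|f x| ^ p)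
  set B := ENNReal.ofReal K * gagP Ω s p α β f
  have hhalf : I / 2 + I / 2 ≤ I / 2 + (A + B) := by
    rw [ENNReal.add_halves]
    calc I ≤ (ENNReal.ofReal (1 / 2) * I + B) + A :=
          hsplit.trans (add_le_add hnear hfar)
      _ = I / 2 + (A + B) := by
          rw [ENNReal.ofReal_div_of_pos two_pos, ENNReal.ofReal_one, ENNReal.ofReal_ofNat,
            one_div, mul_comm, ← div_eq_mul_inv]
          ring
  have hle := (ENNReal.add_le_add_iff_left (ENNReal.div_ne_top hI two_ne_zero)).1 hhalf
  rw [mul_comm]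
  exact (ENNReal.div_le_iff two_ne_zero ENNReal.ofNat_ne_top).1 hle

/-- The weighted bound for measurable representatives. -/
lemma exists_lintegral_le_of_measurable {d : ℕ} {Ω : Set (Rd d)} (hopen : IsOpen Ω)
    (hunif : IsUniformDomain Ω) {s p α β : ℝ} (hs : 0 < s) (hp : 1 ≤ p) (hα : 0 ≤ α) (hβ : 0 ≤ β)
    (h : s * p + α + β < lowerCodimA (frontier Ω)) :
    ∃ c : ℝ, 0 < c ∧ ∀ f : Rd d → ℝ, Measurable f →
      ∫⁻ x in Ω, ENNReal.ofReal (|f x| ^ p) < ⊤ →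
      ∫⁻ x in Ω, ENNReal.ofReal (|f x| ^ p * distBd Ω x ^ (-(s * p + α + β))) ≤
        ENNReal.ofReal c * ((∫⁻ x in Ω, ENNReal.ofReal (|f x| ^ p)) + gagP Ω s p α β f) := by
  have hτ0 : 0 ≤ s * p + α + β := by positivity
  obtain ⟨hEnt, q, ⟨hq0, Cq, hCq, hcodim⟩, hτq⟩ := exists_mem_lowerCodimSet hτ0 h
  have hE := hEnt.nonempty
  have hΩnt : Ω.Nontrivial := by
    by_contra hn
    rw [Set.not_nontrivial_iff] at hn
    exact Set.not_nontrivial_iff.2 (hn.closure.anti frontier_subset_closure) hEnt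
  have hpos : ∀ x ∈ Ω, 0 < distBd Ω x := fun x hx =>
    (isClosed_frontier.notMem_iff_infDist_pos hE).1
      fun hxf => Set.disjoint_left.1 (disjoint_frontier_iff_isOpen.2 hopen) hxf hx
  obtain ⟨κ, r₀, hκ, hκ1, hr₀, hplump⟩ := hunif.exists_plump hΩnt
  obtain ⟨v, hv, hball⟩ := exists_volume_ball_eq d
  obtain ⟨R₀, hR₀, hR₀E⟩ : ∃ R : ℝ, 0 < R ∧ ENNReal.ofReal R < ediam (frontier Ω) := by
    obtain ⟨R, hR0, hR⟩ := ENNReal.lt_iff_exists_nnreal_btwn.1 (ediam_pos_iff.2 hEnt)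
    exact ⟨R, by exact_mod_cast hR0, by simpa using hR⟩
  obtain ⟨M, hM1, hMκ, hMhalf⟩ : ∃ M : ℝ, 1 ≤ M ∧ 2 / κ ≤ M ∧
      shadowConst d κ Cq p (s * p + α + β) * M ^ (s * p + α + β - q) ≤ 1 / 2 := by
    have hlim : Tendsto (fun M : ℝ => shadowConst d κ Cq p (s * p + α + β) *
        M ^ (s * p + α + β - q)) atTop (nhds 0) := by
      have := (tendsto_rpow_neg_atTop (sub_pos.2 hτq)).const_mul
        (shadowConst d κ Cq p (s * p + α + β))
      simpa only [neg_sub, mul_zero] using this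
    exact ((eventually_ge_atTop 1).and ((eventually_ge_atTop (2 / κ)).and
      (hlim.eventually_le_const (by norm_num : (0 : ℝ) < 1 / 2)))).exists
  have hM0 : 0 < M := by linarith
  have hκM : 1 ≤ κ * M / 2 := by
    rw [div_le_iff₀ hκ] at hMκ
    linarith
  obtain ⟨t, ht, htr, htR⟩ : ∃ t : ℝ, 0 < t ∧ M * t ≤ r₀ ∧ 6 / κ * (3 * M * t) ≤ R₀ := by
    refine ⟨min (r₀ / M) (R₀ / (6 / κ * (3 * M))), by positivity, ?_, ?_⟩
    · rw [← le_div_iff₀' hM0]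
      exact min_le_left _ _
    · rw [← mul_assoc, ← le_div_iff₀' (by positivity)]
      exact min_le_right _ _
  have hint : ∀ y, 0 < distBd Ω y → distBd Ω y ≤ 3 * M * t →
      ∫⁻ x, (visiblePairs Ω κ M).indicator
        (fun w => ENNReal.ofReal (visibleKernel Ω v κ M p (s * p + α + β) w.1)) (x, y) ≤
      ENNReal.ofReal (1 / 2 * distBd Ω y ^ (-(s * p + α + β))) := by
    intro y hy hyt
    refine (lintegral_visibleKernel_le hE hq0 hCq hcodim hball hv hκ hκ1 hM1 hτ0 hy ?_).trans ?_
    · refine (ENNReal.ofReal_le_ofReal ?_).trans_lt hR₀E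
      exact le_trans (by gcongr) htR
    · gcongr
  obtain ⟨K, hK⟩ : ∃ K, K = 2 ^ p * v⁻¹ * (κ * M / 2) ^ (-(d : ℝ)) *
    (2 * M) ^ (d + s * p) * (3 * M) ^ β := ⟨_, rfl⟩
  have hK0 : 0 ≤ K := by rw [hK]; positivity
  have htτ : 0 < t ^ (-(s * p + α + β)) := by positivity
  refine ⟨2 * (t ^ (-(s * p + α + β)) + K), by positivity, fun f hf hfin => ?_⟩
  have htrunc : ∀ n : ℕ, ∫⁻ x in Ω ∩ {x | ((n : ℝ) + 1)⁻¹ < distBd Ω x},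
      ENNReal.ofReal (|f x| ^ p * distBd Ω x ^ (-(s * p + α + β))) ≤
      ENNReal.ofReal (2 * (t ^ (-(s * p + α + β)) + K)) *
        ((∫⁻ x in Ω, ENNReal.ofReal (|f x| ^ p)) + gagP Ω s p α β f) := by
    intro n
    refine (lintegral_truncated_le hopen hpos hball hv hκ hκ1 hM1 hκM hs hp hα hβ ht
      (by positivity) htr hplump hint hf hfin).trans ?_
    rw [← hK, ENNReal.ofReal_mul two_pos.le, ENNReal.ofReal_ofNat, mul_assoc,
      mul_add (ENNReal.ofReal _)]
    refine mul_le_mul_right (add_le_add ?_ ?_) _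
    · exact mul_le_mul_left (ENNReal.ofReal_le_ofReal (by linarith)) _
    · exact mul_le_mul_left (ENNReal.ofReal_le_ofReal (by linarith)) _
  have hunion : Ω = ⋃ n : ℕ, Ω ∩ {x | ((n : ℝ) + 1)⁻¹ < distBd Ω x} := by
    refine Set.Subset.antisymm (fun x hx => ?_) (Set.iUnion_subset fun n => Set.inter_subset_left)
    obtain ⟨n, hn⟩ := exists_nat_one_div_lt (hpos x hx)
    rw [one_div] at hn
    exact Set.mem_iUnion.2 ⟨n, hx, hn⟩
  have hmono : Monotone fun n : ℕ => Ω ∩ {x | ((n : ℝ) + 1)⁻¹ < distBd Ω x} := by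
    intro m n hmn x hx
    have hmn' : (m : ℝ) ≤ n := by exact_mod_cast hmn
    have hinv : ((n : ℝ) + 1)⁻¹ ≤ ((m : ℝ) + 1)⁻¹ := inv_anti₀ (by positivity) (by linarith)
    exact ⟨hx.1, hinv.trans_lt hx.2⟩
  have hsup := setLIntegral_iUnion_of_directed (μ := volume)
    (fun x => ENNReal.ofReal (|f x| ^ p * distBd Ω x ^ (-(s * p + α + β))))
    (directed_of_isDirected_le hmono)
  rw [← hunion] at hsup
  rw [hsup]
  exact iSup_le htrunc

lemma eLpNorm_rpow_eq_lintegral {d : ℕ} (Ω : Set (Rd d)) {p : ℝ} (hp : 1 ≤ p) (f : Rd d → ℝ) :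
    eLpNorm f (ENNReal.ofReal p) (volume.restrict Ω) ^ p =
      ∫⁻ x in Ω, ENNReal.ofReal (|f x| ^ p) := by
  have hp0 : 0 < p := by linarith
  rw [eLpNorm_eq_eLpNorm' (by simpa using hp0) ENNReal.ofReal_ne_top, ENNReal.toReal_ofReal hp0.le,
    ← lintegral_rpow_enorm_eq_rpow_eLpNorm' hp0]
  refine lintegral_congr fun x => ?_
  rw [Real.enorm_eq_ofReal_abs, ENNReal.ofReal_rpow_of_nonneg (abs_nonneg _) hp0.le]

lemma gagP_congr_ae {d : ℕ} {Ω : Set (Rd d)} (s p α β : ℝ) {f g : Rd d → ℝ}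
    (h : f =ᵐ[volume.restrict Ω] g) : gagP Ω s p α β f = gagP Ω s p α β g := by
  unfold gagP
  refine lintegral_congr_ae ?_
  filter_upwards [h] with x hx
  refine lintegral_congr_ae ?_
  filter_upwards [h] with y hy
  rw [hx, hy]

/-- the embedding `W^{s,p;α,β}(Ω) ⊂ L^p(Ω, d_Ω^{-sp-α-β})` when
`sp + α + β < codim_A(∂Ω)`. -/
theorem stmt7 {d : ℕ} (Ω : Set (Rd d)) (hne : Ω.Nonempty)
    (hopen : IsOpen Ω) (hconn : IsConnected Ω) (hbdd : Bornology.IsBounded Ω)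
    (hunif : IsUniformDomain Ω) (s p α β : ℝ)
    (hs0 : 0 < s) (hs1 : s < 1) (hp : 1 ≤ p)
    (hα0 : 0 ≤ α) (hα : α < lowerCodimA (frontier Ω))
    (hβ0 : 0 ≤ β) (hβ : β < lowerCodimA (frontier Ω))
    (h : s * p + α + β < lowerCodimA (frontier Ω)) :
    ∃ c : ℝ, 0 < c ∧ ∀ f : Rd d → ℝ, memW Ω s p α β f →
      (∫⁻ x in Ω, ENNReal.ofReal (|f x| ^ p * distBd Ω x ^ (-(s * p + α + β))))
          ≤ ENNReal.ofReal c * wNorm Ω s p α β f ^ p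
        ∧ ENNReal.ofReal c * wNorm Ω s p α β f ^ p < ⊤ := by
  obtain ⟨c, hc, hbound⟩ := exists_lintegral_le_of_measurable hopen hunif hs0 hp hα0 hβ0 h
  have hp0 : 0 < p := by linarith
  refine ⟨2 * c, by positivity, fun f ⟨hfL, hfG⟩ => ⟨?_, ?_⟩⟩
  · obtain ⟨g, hg, hfg⟩ := hfL.aestronglyMeasurable.aemeasurable
    have hLp := eLpNorm_rpow_eq_lintegral Ω hp g
    rw [← eLpNorm_congr_ae hfg] at hLp
    have hfin : ∫⁻ x in Ω, ENNReal.ofReal (|g x| ^ p) < ⊤ := by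
      rw [← hLp]
      exact ENNReal.rpow_lt_top_of_nonneg hp0.le hfL.eLpNorm_ne_top
    have hb := hbound g hg hfin
    rw [← hLp, ← gagP_congr_ae s p α β hfg] at hb
    have hlhs : ∫⁻ x in Ω, ENNReal.ofReal (|f x| ^ p * distBd Ω x ^ (-(s * p + α + β))) =
        ∫⁻ x in Ω, ENNReal.ofReal (|g x| ^ p * distBd Ω x ^ (-(s * p + α + β))) := by
      refine lintegral_congr_ae ?_
      filter_upwards [hfg] with x hx
      rw [hx]
    have hnorm : eLpNorm f (ENNReal.ofReal p) (volume.restrict Ω) ^ p ≤ wNorm Ω s p α β f ^ p :=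
      ENNReal.rpow_le_rpow le_self_add hp0.le
    have hsemi : gagP Ω s p α β f ≤ wNorm Ω s p α β f ^ p := by
      calc gagP Ω s p α β f = gagSemi Ω s p α β f ^ p := by
            rw [gagSemi, ← ENNReal.rpow_mul, one_div, inv_mul_cancel₀ hp0.ne', ENNReal.rpow_one]
        _ ≤ _ := ENNReal.rpow_le_rpow le_add_self hp0.le
    rw [hlhs, mul_comm 2 c, ENNReal.ofReal_mul hc.le, ENNReal.ofReal_ofNat, mul_assoc, two_mul]
    exact hb.trans (mul_le_mul_right (add_le_add hnorm hsemi) _)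
  · refine ENNReal.mul_lt_top ENNReal.ofReal_lt_top
      (ENNReal.rpow_lt_top_of_nonneg hp0.le (ENNReal.add_ne_top.2 ⟨hfL.eLpNorm_ne_top, ?_⟩))
    exact (ENNReal.rpow_lt_top_of_nonneg (by positivity) hfG.ne).ne
end

section
/- Let Ω ⊂ ℝ^d be a bounded, uniform domain, let 0 < s < 1, 1 ≤ p < ∞, 0 ≤ α, β < codim̲_A(∂Ω), and suppose α + β < d − dim̄_M(∂Ω) + p(1−s). Then C_c^∞(Ω) ⊂ W^{s,p;α,β}(Ω), i.e. every smooth compactly supported function φ on Ω satisfies [φ]_{W^{s,p;α,β}(Ω)} < ∞. -/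
open MeasureTheory Metric Set Filter
open scoped ENNReal NNReal

/-- If the `r`-neighbourhoods of `E` have measure `O(r ^ q)`, then `dist(·, E) ^ (-β)` is integrable
on sets of finite measure away from the closure of `E`, for every `0 ≤ β < q`. -/
theorem lintegral_infDist_rpow_neg_lt_top {X : Type*} [PseudoMetricSpace X] [MeasurableSpace X]
    [OpensMeasurableSpace X] {μ : Measure X} {E S : Set X} (hE : E.Nonempty)
    (hSm : MeasurableSet S) (hS : μ S < ⊤) (hpos : ∀ x ∈ S, 0 < infDist x E)
    {β q ρ A : ℝ} (hβ : 0 ≤ β) (hβq : β < q) (hρ : 0 < ρ)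
    (hvol : ∀ r, 0 < r → r ≤ ρ → μ (cthickening r E) ≤ ENNReal.ofReal (A * r ^ q)) :
    ∫⁻ x in S, ENNReal.ofReal (infDist x E ^ (-β)) ∂μ < ⊤ := by
  set g : ℕ → X → ℝ≥0∞ := fun k => (cthickening (ρ * (1 / 2) ^ k) E).indicator
    fun _ => ENNReal.ofReal ((ρ * (1 / 2) ^ (k + 1)) ^ (-β)) with hg
  have hgm : ∀ k, Measurable (g k) := fun k =>
    measurable_const.indicator isClosed_cthickening.measurableSet
  have hpt : ∀ x ∈ S, ENNReal.ofReal (infDist x E ^ (-β))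
      ≤ ENNReal.ofReal (ρ ^ (-β)) + ∑' k, g k x := by
    intro x hx
    have hx0 := hpos x hx
    rcases le_or_gt ρ (infDist x E) with hle | hlt
    · exact le_add_right (ENNReal.ofReal_le_ofReal
        (Real.rpow_le_rpow_of_nonpos hρ hle (neg_nonpos.2 hβ)))
    · obtain ⟨k, hk1, hk2⟩ := exists_nat_pow_near_of_lt_one (x := infDist x E / ρ)
        (y := (1 / 2 : ℝ)) (by positivity) ((div_le_one hρ).2 hlt.le) (by norm_num) (by norm_num)
      rw [lt_div_iff₀ hρ, mul_comm] at hk1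
      rw [div_le_iff₀ hρ, mul_comm] at hk2
      refine le_add_left (le_trans ?_ (ENNReal.le_tsum k))
      have hmem : x ∈ cthickening (ρ * (1 / 2) ^ k) E := by
        rw [mem_cthickening_iff]
        exact ENNReal.le_ofReal_iff_toReal_le (infEDist_ne_top hE) (by positivity) |>.2 hk2
      rw [hg]
      simp only [indicator_of_mem hmem]
      exact ENNReal.ofReal_le_ofReal
        (Real.rpow_le_rpow_of_nonpos (by positivity) hk1.le (neg_nonpos.2 hβ))
  have hterm : ∀ k, ∫⁻ x in S, g k x ∂μ ≤
      ENNReal.ofReal (A * (ρ ^ q * (ρ / 2) ^ (-β)) * ((1 / 2 : ℝ) ^ (q - β)) ^ k) := by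
    intro k
    have hk : 0 < (1 / 2 : ℝ) ^ k := by positivity
    calc ∫⁻ x in S, g k x ∂μ ≤ ∫⁻ x, g k x ∂μ := setLIntegral_le_lintegral _ _
      _ = ENNReal.ofReal ((ρ * (1 / 2) ^ (k + 1)) ^ (-β)) * μ (cthickening (ρ * (1 / 2) ^ k) E) :=
        lintegral_indicator_const isClosed_cthickening.measurableSet _
      _ ≤ ENNReal.ofReal ((ρ * (1 / 2) ^ (k + 1)) ^ (-β)) *
          ENNReal.ofReal (A * (ρ * (1 / 2) ^ k) ^ q) := by
        gcongr
        refine hvol _ (by positivity) ?_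
        exact mul_le_of_le_one_right hρ.le (pow_le_one₀ (by norm_num) (by norm_num))
      _ = _ := by
        rw [← ENNReal.ofReal_mul (by positivity)]
        congr 1
        rw [show ρ * (1 / 2 : ℝ) ^ (k + 1) = (ρ / 2) * (1 / 2) ^ k by ring,
          Real.mul_rpow (by positivity) hk.le, Real.mul_rpow hρ.le hk.le,
          ← Real.rpow_natCast ((1 / 2 : ℝ) ^ (q - β)), ← Real.rpow_mul (by norm_num),
          mul_comm (q - β), Real.rpow_mul (by norm_num), Real.rpow_natCast,
          sub_eq_add_neg, Real.rpow_add hk]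
        ring
  have hsum : Summable fun k : ℕ =>
      A * (ρ ^ q * (ρ / 2) ^ (-β)) * ((1 / 2 : ℝ) ^ (q - β)) ^ k :=
    (summable_geometric_of_lt_one (by positivity)
      (Real.rpow_lt_one (by norm_num) (by norm_num) (sub_pos.2 hβq))).mul_left _
  calc ∫⁻ x in S, ENNReal.ofReal (infDist x E ^ (-β)) ∂μ
      ≤ ∫⁻ x in S, (ENNReal.ofReal (ρ ^ (-β)) + ∑' k, g k x) ∂μ := setLIntegral_mono' hSm hpt
    _ = ENNReal.ofReal (ρ ^ (-β)) * μ S + ∑' k, ∫⁻ x in S, g k x ∂μ := by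
      rw [lintegral_add_left measurable_const, setLIntegral_const,
        lintegral_tsum fun k => (hgm k).aemeasurable]
    _ ≤ ENNReal.ofReal (ρ ^ (-β)) * μ S + ∑' k,
        ENNReal.ofReal (A * (ρ ^ q * (ρ / 2) ^ (-β)) * ((1 / 2 : ℝ) ^ (q - β)) ^ k) := by
      gcongr with k
      exact hterm k
    _ < ⊤ := ENNReal.add_lt_top.2 ⟨ENNReal.mul_lt_top ENNReal.ofReal_lt_top hS,
      hsum.tsum_ofReal_lt_top⟩

/-- An exponent admissible for the lower Assouad codimension of a compact set controls the volume of
all small neighbourhoods of that set. -/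
theorem exists_volume_cthickening_le {d : ℕ} {E : Set (Rd d)} (hE : IsCompact E)
    (hdiam : 0 < Metric.ediam E) {q : ℝ} (hq : q ∈ lowerCodimSet E) :
    ∃ ρ A : ℝ, 0 < ρ ∧ ∀ r, 0 < r → r ≤ ρ →
      volume (cthickening r E) ≤ ENNReal.ofReal (A * r ^ q) := by
  obtain ⟨-, C, hC, hvol⟩ := hq
  obtain ⟨R, hR0, hR⟩ : ∃ R : ℝ, 0 < R ∧ ENNReal.ofReal R < Metric.ediam E := by
    obtain ⟨R, hR0, hR⟩ := ENNReal.lt_iff_exists_nnreal_btwn.1 hdiam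
    exact ⟨R, by simpa using hR0, by simpa using hR⟩
  obtain ⟨t, htE, htfin, htcov⟩ := hE.finite_cover_balls (half_pos hR0)
  lift t to Finset (Rd d) using htfin
  set V := volume (ball (0 : Rd d) R) with hV
  have hVtop : V ≠ ⊤ := measure_ball_lt_top.ne
  refine ⟨R / 4, t.card * (C * (1 / R) ^ q * V.toReal), by positivity,
    fun r hr hrR => ?_⟩
  have hsub : cthickening r E ⊆ ⋃ x ∈ t, (cthickening r E ∩ ball x R) := by
    intro y hy
    have hy' := hy
    rw [hE.cthickening_eq_biUnion_closedBall hr.le, mem_iUnion₂] at hy'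
    obtain ⟨z, hz, hyz⟩ := hy'
    obtain ⟨x, hx, hzx⟩ := mem_iUnion₂.1 (htcov hz)
    refine mem_iUnion₂.2 ⟨x, hx, hy, ?_⟩
    rw [mem_ball] at hzx ⊢
    rw [mem_closedBall] at hyz
    linarith [dist_triangle y z x]
  calc volume (cthickening r E) ≤ ∑ x ∈ t, volume (cthickening r E ∩ ball x R) :=
        (measure_mono hsub).trans (measure_biUnion_finset_le _ _)
    _ ≤ ∑ _x ∈ t, ENNReal.ofReal (C * (r / R) ^ q) * V := by
        refine Finset.sum_le_sum fun x hx => ?_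
        rw [hV, ← Measure.addHaar_ball_center volume x R]
        exact hvol x (htE hx) r R hr (by linarith) hR
    _ = ENNReal.ofReal (t.card * (C * (1 / R) ^ q * V.toReal) * r ^ q) := by
        rw [Finset.sum_const, nsmul_eq_mul, ← ENNReal.ofReal_natCast,
          ← ENNReal.ofReal_toReal hVtop, ← ENNReal.ofReal_mul (by positivity),
          ← ENNReal.ofReal_mul (by positivity), ENNReal.toReal_ofReal (by positivity),
          show r / R = 1 / R * r by ring, Real.mul_rpow (by positivity) hr.le]
        congr 1
        ring

/-- A set whose lower Assouad codimension is positive has positive diameter: for sets of diameter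
zero every exponent is admissible, and the real supremum takes its default value `0`. -/
theorem ediam_pos_of_lowerCodimA_pos {d : ℕ} {E : Set (Rd d)} (h : 0 < lowerCodimA E) :
    0 < Metric.ediam E := by
  by_contra hdiam
  have hset : lowerCodimSet E = Ici 0 := by
    ext q
    refine ⟨fun hq => hq.1, fun hq => ⟨hq, 1, le_rfl, fun x _ r R _ _ hR => ?_⟩⟩
    exact absurd (lt_of_le_of_lt zero_le hR) hdiam
  rw [lowerCodimA, hset, Real.sSup_of_not_bddAbove (not_bddAbove_Ici 0)] at h
  exact lt_irrefl _ h

/-- In a bounded open set, `d_Ω ^ (-β)` is integrable for `0 ≤ β` below the lower Assouad codimension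
of the boundary. -/
theorem lintegral_distBd_rpow_neg_lt_top {d : ℕ} {Ω : Set (Rd d)} (hopen : IsOpen Ω)
    (hbdd : Bornology.IsBounded Ω) {β : ℝ} (hβ0 : 0 ≤ β) (hβ : β < lowerCodimA (frontier Ω)) :
    ∫⁻ x in Ω, ENNReal.ofReal (distBd Ω x ^ (-β)) < ⊤ := by
  have hdiam := ediam_pos_of_lowerCodimA_pos (hβ0.trans_lt hβ)
  have hne := (ediam_pos_iff.1 hdiam).nonempty
  have hset : (lowerCodimSet (frontier Ω)).Nonempty := by
    by_contra hempty
    rw [lowerCodimA, not_nonempty_iff_eq_empty.1 hempty, Real.sSup_empty] at hβ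
    exact hβ.not_ge hβ0
  obtain ⟨q, hq, hβq⟩ := exists_lt_of_lt_csSup hset hβ
  have hcpt : IsCompact (frontier Ω) := isCompact_of_isClosed_isBounded isClosed_frontier
    (hbdd.closure.subset frontier_subset_closure)
  obtain ⟨ρ, A, hρ, hvol⟩ := exists_volume_cthickening_le hcpt hdiam hq
  refine lintegral_infDist_rpow_neg_lt_top hne hopen.measurableSet hbdd.measure_lt_top
    (fun x hx => ?_) hβ0 hβq hρ hvol
  refine (isClosed_frontier.notMem_iff_infDist_pos hne).1 fun hxf => ?_
  rw [hopen.frontier_eq] at hxf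
  exact hxf.2 hx

/-- The Gagliardo integrand of a bounded Lipschitz function vanishing near `∂Ω` is dominated by a
product of the two weights away from the diagonal and by a Riesz kernel near the diagonal. -/
theorem gagliardo_integrand_le {d : ℕ} {Ω : Set (Rd d)} {s p α β δ M : ℝ} {L : ℝ≥0}
    {φ : Rd d → ℝ} (hs0 : 0 < s) (hp : 1 ≤ p) (hα0 : 0 ≤ α) (hβ0 : 0 ≤ β) (hδ : 0 < δ)
    (hM : ∀ x, |φ x| ≤ M) (hL : LipschitzWith L φ)
    (hφδ : ∀ x, φ x ≠ 0 → 2 * δ ≤ distBd Ω x) (x y : Rd d) :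
    |φ x - φ y| ^ p / dist x y ^ ((d : ℝ) + s * p) * distBd Ω y ^ (-β) * distBd Ω x ^ (-α)
      ≤ (2 * M) ^ p / δ ^ ((d : ℝ) + s * p) * distBd Ω y ^ (-β) * distBd Ω x ^ (-α)
        + (L : ℝ) ^ p * δ ^ (-β) * δ ^ (-α) *
          (ball (0 : Rd d) δ).indicator (fun z => ‖z‖ ^ (-((d : ℝ) + s * p - p))) (x - y) := by
  have hM0 : 0 ≤ M := (abs_nonneg _).trans (hM x)
  have hsp : 0 ≤ (d : ℝ) + s * p := by positivity
  have hwx : 0 ≤ distBd Ω x := infDist_nonneg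
  have hwy : 0 ≤ distBd Ω y := infDist_nonneg
  have hind : 0 ≤ (ball (0 : Rd d) δ).indicator
      (fun z => ‖z‖ ^ (-((d : ℝ) + s * p - p))) (x - y) :=
    indicator_nonneg (fun z _ => by positivity) _
  rcases le_or_gt δ (dist x y) with hfar | hnear
  · refine le_add_of_le_of_nonneg ?_ (by positivity)
    have hdiff : |φ x - φ y| ≤ 2 * M := by
      linarith [abs_sub (φ x) (φ y), hM x, hM y]
    gcongr
  · refine le_add_of_nonneg_of_le (by positivity) ?_
    rcases eq_or_ne (φ x) (φ y) with heq | hneq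
    · rw [heq, sub_self, abs_zero, Real.zero_rpow (by linarith)]
      simp only [zero_div, zero_mul]
      positivity
    have hxy : 0 < dist x y := dist_pos.2 fun h => hneq (congrArg φ h)
    have hd1 : distBd Ω x ≤ distBd Ω y + dist x y := infDist_le_infDist_add_dist
    have hd2 : distBd Ω y ≤ distBd Ω x + dist y x := infDist_le_infDist_add_dist
    rw [dist_comm y x] at hd2
    have hboth : δ ≤ distBd Ω x ∧ δ ≤ distBd Ω y := by
      by_cases hx : φ x = 0
      · have := hφδ y fun h => hneq (hx.trans h.symm)
        constructor <;> linarith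
      · have := hφδ x hx
        constructor <;> linarith
    have hmem : x - y ∈ ball (0 : Rd d) δ := by rwa [mem_ball_zero_iff, ← dist_eq_norm]
    have hlip : |φ x - φ y| ≤ L * dist x y := by
      simpa [Real.dist_eq] using hL.dist_le_mul x y
    rw [indicator_of_mem hmem, ← dist_eq_norm]
    calc |φ x - φ y| ^ p / dist x y ^ ((d : ℝ) + s * p) * distBd Ω y ^ (-β) * distBd Ω x ^ (-α)
        ≤ (L * dist x y) ^ p / dist x y ^ ((d : ℝ) + s * p) * δ ^ (-β) * δ ^ (-α) := by
          have h1 := Real.rpow_le_rpow_of_nonpos hδ hboth.1 (neg_nonpos.2 hα0)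
          have h2 := Real.rpow_le_rpow_of_nonpos hδ hboth.2 (neg_nonpos.2 hβ0)
          gcongr
      _ = _ := by
          rw [Real.mul_rpow L.coe_nonneg hxy.le, neg_sub, Real.rpow_sub hxy]
          ring

/-- Locally integrable Riesz kernels have finite integral over balls. -/
theorem lintegral_indicator_ball_norm_rpow_lt_top {d : ℕ} (hd : 1 ≤ d) {γ : ℝ}
    (hγ : γ < d) (δ : ℝ) :
    ∫⁻ z, ENNReal.ofReal ((ball (0 : Rd d) δ).indicator (fun z => ‖z‖ ^ (-γ)) z) < ⊤ := by
  have hmeas : Measurable fun z : Rd d => ‖z‖ ^ (-γ) := by fun_prop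
  have hint : IntegrableOn (fun z : Rd d => ‖z‖ ^ (-γ)) (ball 0 δ) volume := by
    refine integrableOn_ball_of_norm_le_rpow (C := 1) (α := γ) (by simpa using hd)
      (by simpa using hγ) (ae_of_all _ fun z => ?_) hmeas.aestronglyMeasurable
    rw [one_mul, Real.norm_of_nonneg (by positivity)]
  exact ((integrable_indicator_iff measurableSet_ball).2 hint).lintegral_lt_top

/-- for a bounded uniform domain, if `0 ≤ α, β < codim_A(∂Ω)` and
`α + β < d - dim_M(∂Ω) + p(1-s)`, then `C_c^∞(Ω) ⊂ W^{s,p;α,β}(Ω)`. -/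
theorem stmt9 {d : ℕ} (Ω : Set (Rd d)) (hne : Ω.Nonempty)
    (hopen : IsOpen Ω) (hconn : IsConnected Ω) (hbdd : Bornology.IsBounded Ω)
    (hunif : IsUniformDomain Ω) (s p α β : ℝ)
    (hs0 : 0 < s) (hs1 : s < 1) (hp : 1 ≤ p)
    (hα0 : 0 ≤ α) (hα : α < lowerCodimA (frontier Ω))
    (hβ0 : 0 ≤ β) (hβ : β < lowerCodimA (frontier Ω))
    (h : α + β < (d : ℝ) - upperMinkDim (frontier Ω) + p * (1 - s)) :
    ∀ φ : Rd d → ℝ, ContDiff ℝ (⊤ : ℕ∞) φ → HasCompactSupport φ → tsupport φ ⊆ Ω →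
      memW Ω s p α β φ := by
  intro φ hφ hcs hsupp
  refine ⟨hφ.continuous.memLp_of_hasCompactSupport hcs, ?_⟩
  have hdiam := ediam_pos_of_lowerCodimA_pos (hα0.trans_lt hα)
  have hnt := ediam_pos_iff.1 hdiam
  have hfne := hnt.nonempty
  have hd : 1 ≤ d := by
    by_contra hd
    obtain rfl : d = 0 := by omega
    exact (Set.not_nontrivial_iff.2 Set.subsingleton_of_subsingleton) hnt
  obtain ⟨L, hL⟩ := hφ.lipschitzWith_of_hasCompactSupport hcs (by simp)
  obtain ⟨M, hM⟩ := hcs.exists_bound_of_continuous hφ.continuous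
  obtain ⟨δ, hδ, hφδ⟩ : ∃ δ : ℝ, 0 < δ ∧ ∀ x, φ x ≠ 0 → 2 * δ ≤ distBd Ω x := by
    have hcont : Continuous (distBd Ω) := continuous_infDist_pt _
    have hpos : ∀ x ∈ tsupport φ, 0 < distBd Ω x := fun x hx => by
      refine (isClosed_frontier.notMem_iff_infDist_pos hfne).1 fun hxf => ?_
      rw [hopen.frontier_eq] at hxf
      exact hxf.2 (hsupp hx)
    obtain ⟨ε, hε, hle⟩ := hcs.isCompact.exists_forall_le' hcont.continuousOn hpos
    exact ⟨ε / 2, half_pos hε, fun x hx => by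
      linarith [hle x (subset_tsupport φ hx)]⟩
  set a : ℝ := (2 * M) ^ p / δ ^ ((d : ℝ) + s * p) with ha
  set b : ℝ := (L : ℝ) ^ p * δ ^ (-β) * δ ^ (-α) with hb
  set G : Rd d → ℝ≥0∞ := fun z => ENNReal.ofReal
    ((ball (0 : Rd d) δ).indicator (fun z => ‖z‖ ^ (-((d : ℝ) + s * p - p))) z) with hG
  have hM0 : 0 ≤ M := (norm_nonneg _).trans (hM 0)
  have ha0 : 0 ≤ a := by positivity
  have hb0 : 0 ≤ b := by positivity
  have hwm : ∀ γ : ℝ, Measurable fun x => ENNReal.ofReal (distBd Ω x ^ γ) := fun γ => by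
    have : Measurable (distBd Ω) := (continuous_infDist_pt _).measurable
    fun_prop
  have hGm : Measurable G := by
    have : Measurable fun z : Rd d => ‖z‖ ^ (-((d : ℝ) + s * p - p)) := by fun_prop
    exact (this.indicator measurableSet_ball).ennreal_ofReal
  have hGfin : ∫⁻ z, G z < ⊤ :=
    lintegral_indicator_ball_norm_rpow_lt_top hd (by nlinarith) δ
  have hIα := lintegral_distBd_rpow_neg_lt_top hopen hbdd hα0 hα
  have hIβ := lintegral_distBd_rpow_neg_lt_top hopen hbdd hβ0 hβ
  set Iβ := ∫⁻ y in Ω, ENNReal.ofReal (distBd Ω y ^ (-β)) with hIβdef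
  have hpt : ∀ x y, ENNReal.ofReal (|φ x - φ y| ^ p / dist x y ^ ((d : ℝ) + s * p)
      * distBd Ω y ^ (-β) * distBd Ω x ^ (-α)) ≤
      ENNReal.ofReal a * ENNReal.ofReal (distBd Ω x ^ (-α)) * ENNReal.ofReal (distBd Ω y ^ (-β))
        + ENNReal.ofReal b * G (x - y) := by
    intro x y
    have hwx : 0 ≤ distBd Ω x := infDist_nonneg
    have hwy : 0 ≤ distBd Ω y := infDist_nonneg
    refine (ENNReal.ofReal_le_ofReal
      (gagliardo_integrand_le hs0 hp hα0 hβ0 hδ hM hL hφδ x y)).trans ?_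
    refine ENNReal.ofReal_add_le.trans (le_of_eq ?_)
    rw [← ha, ← hb, ENNReal.ofReal_mul hb0, ENNReal.ofReal_mul (by positivity),
      ENNReal.ofReal_mul ha0]
    ring
  have hinner : ∀ x, ∫⁻ y in Ω, ENNReal.ofReal (|φ x - φ y| ^ p / dist x y ^ ((d : ℝ) + s * p)
      * distBd Ω y ^ (-β) * distBd Ω x ^ (-α)) ≤
      ENNReal.ofReal a * Iβ * ENNReal.ofReal (distBd Ω x ^ (-α))
        + ENNReal.ofReal b * ∫⁻ z, G z := by
    intro x
    have hGx : Measurable fun y => G (x - y) := hGm.comp (measurable_const_sub x)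
    refine (lintegral_mono (hpt x)).trans ?_
    rw [lintegral_add_left ((hwm _).const_mul _), lintegral_const_mul _ (hwm _),
      lintegral_const_mul _ hGx, ← hIβdef,
      mul_right_comm]
    exact add_le_add le_rfl (mul_le_mul' le_rfl ((setLIntegral_le_lintegral _ _).trans_eq
      (lintegral_sub_left_eq_self (μ := volume) G x)))
  refine (lintegral_mono hinner).trans_lt ?_
  rw [lintegral_add_left ((hwm _).const_mul _), lintegral_const_mul _ (hwm _), setLIntegral_const]
  exact ENNReal.add_lt_top.2 ⟨ENNReal.mul_lt_top (ENNReal.mul_lt_top ENNReal.ofReal_lt_top hIβ) hIα,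
    ENNReal.mul_lt_top (ENNReal.mul_lt_top ENNReal.ofReal_lt_top hGfin) hbdd.measure_lt_top⟩
end
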